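/- arXiv:2207.04580 — 7 statements merged into one kernel-verified Lean document; each statement's English description precedes it below -/
import Mathlib

section
/- The nonlocal pressure gradient is exact on linear pressure fields: if g₀ ∈ ℝ³, Φ(ζ) = ⟨g₀, ζ⟩ for all ζ, ζ ↦ ω(ζ)‖ζ‖² is integrable on H, and the shape tensor K is invertible, then the nonlocal pressure gradient K⁻¹ (∫_H ω(ζ) Φ(ζ) ζ dζ) equals g₀. -/
open MeasureTheory Matrix

section SecondMoment

variable {ι : Type*} [Fintype ι] {μ : Measure (EuclideanSpace ℝ ι)} {ω : EuclideanSpace ℝ ι → ℝ}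

/-- A weight with integrable second moment has integrable mixed second moments. -/
theorem integrable_weight_mul_coord_mul_coord (hω : Measurable ω)
    (hint : Integrable (fun ζ => ω ζ * ‖ζ‖ ^ 2) μ) (i j : ι) :
    Integrable (fun ζ => ω ζ * ζ i * ζ j) μ := by
  refine hint.mono (by fun_prop) (Filter.Eventually.of_forall fun ζ => ?_)
  rw [mul_assoc, norm_mul, norm_mul, norm_mul, norm_pow, norm_norm, sq]
  gcongr <;> exact PiLp.norm_apply_le ζ _

/-- The first moment of a weighted linear field is the second moment matrix applied to the
gradient of the field. -/
theorem integral_weight_mul_linear_mul_coord (hω : Measurable ω)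
    (hint : Integrable (fun ζ => ω ζ * ‖ζ‖ ^ 2) μ) (g : ι → ℝ) (j : ι) :
    ∫ ζ, ω ζ * (∑ i, g i * ζ i) * ζ j ∂μ = ∑ i, (∫ ζ, ω ζ * ζ j * ζ i ∂μ) * g i := by
  simp_rw [← integral_mul_const]
  rw [← integral_finsetSum _ fun i _ =>
    (integrable_weight_mul_coord_mul_coord hω hint j i).mul_const (g i)]
  congr 1 with ζ
  rw [Finset.mul_sum, Finset.sum_mul]
  exact Finset.sum_congr rfl fun i _ => by ring

end SecondMoment

/-- The nonlocal pressure gradient is exact on linear pressure fields: if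
`Φ(ζ) = ⟨g₀, ζ⟩` and the shape tensor `K` is invertible, then
`K⁻¹ (∫_H ω Φ ζ dζ) = g₀`. -/
theorem nonlocal_pressure_gradient_exact_on_linear
    (δ : ℝ) (hδ : 0 < δ)
    (ω : EuclideanSpace ℝ (Fin 3) → ℝ)
    (hωmeas : Measurable ω) (hωnn : ∀ ζ, 0 ≤ ω ζ)
    (hωint : IntegrableOn (fun ζ => ω ζ * ‖ζ‖ ^ 2)
      (Metric.closedBall (0 : EuclideanSpace ℝ (Fin 3)) δ))
    (g₀ : Fin 3 → ℝ)
    (Φ : EuclideanSpace ℝ (Fin 3) → ℝ)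
    (hΦ : ∀ ζ, Φ ζ = ∑ i, g₀ i * ζ i)
    (K : Matrix (Fin 3) (Fin 3) ℝ)
    (hK : ∀ i j, K i j =
      ∫ ζ in Metric.closedBall (0 : EuclideanSpace ℝ (Fin 3)) δ, ω ζ * ζ i * ζ j)
    (hKunit : IsUnit K) :
    ∀ i, (∑ j, K⁻¹ i j *
      ∫ ζ in Metric.closedBall (0 : EuclideanSpace ℝ (Fin 3)) δ, ω ζ * Φ ζ * ζ j) = g₀ i := by
  have hmoment (j : Fin 3) :
      ∫ ζ in Metric.closedBall (0 : EuclideanSpace ℝ (Fin 3)) δ, ω ζ * Φ ζ * ζ j =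
        (K *ᵥ g₀) j := by
    simp_rw [hΦ, integral_weight_mul_linear_mul_coord hωmeas hωint, ← hK]
    rfl
  intro i
  simp_rw [hmoment]
  change (K⁻¹ *ᵥ (K *ᵥ g₀)) i = g₀ i
  rw [mulVec_mulVec, nonsing_inv_mul K ((isUnit_iff_isUnit_det K).mp hKunit), one_mulVec]
end

section
/- Pointwise correspondence identity for fluid-flow dissipation: let q ∈ ℝ³ (the fluid flux), let Φ : ℝ³ → ℝ be measurable with ζ ↦ ω(ζ)|Φ(ζ)|‖ζ‖ integrable on H, and suppose the shape tensor K is invertible. Define the nonlocal pressure gradient g = K⁻¹ (∫_H ω(ζ) Φ(ζ) ζ dζ) and the fluid flow state Q(ζ) = ω(ζ) ⟨q, K⁻¹ ζ⟩. Then the classical dissipation equals the peridynamic dissipation: ⟨q, g⟩ = ∫_H Q(ζ) Φ(ζ) dζ. -/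
open MeasureTheory Matrix

/-- If the weighted scalar state `ω |Φ| ‖·‖` is integrable on `s`, so is each component of the
vector-valued integrand `ω Φ ζ`. -/
theorem integrableOn_mul_coord {ι : Type*} [Fintype ι] {s : Set (EuclideanSpace ℝ ι)}
    {ω Φ : EuclideanSpace ℝ ι → ℝ} (hω : Measurable ω) (hΦ : Measurable Φ)
    (h : IntegrableOn (fun ζ => ω ζ * |Φ ζ| * ‖ζ‖) s) (j : ι) :
    IntegrableOn (fun ζ => ω ζ * Φ ζ * ζ j) s := by
  refine Integrable.mono h ?_ (ae_of_all _ fun ζ => ?_)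
  · have hj : Measurable fun ζ : EuclideanSpace ℝ ι => ζ j := by fun_prop
    exact ((hω.mul hΦ).mul hj).aestronglyMeasurable
  · simp only [norm_mul, Real.norm_eq_abs, abs_abs, abs_norm]
    refine mul_le_mul_of_nonneg_left ?_ (by positivity)
    exact PiLp.norm_apply_le ζ j

/-- Pointwise correspondence identity for fluid-flow dissipation: the classical
dissipation `⟨q, g⟩` equals the peridynamic dissipation `∫_H Q(ζ) Φ(ζ) dζ`, where
`Q(ζ) = ω(ζ) ⟨q, K⁻¹ ζ⟩` is the fluid flow state. -/
theorem correspondence_dissipation_identity_fluid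
    (δ : ℝ) (hδ : 0 < δ)
    (ω : EuclideanSpace ℝ (Fin 3) → ℝ)
    (hωmeas : Measurable ω) (hωnn : ∀ ζ, 0 ≤ ω ζ)
    (hωint : IntegrableOn (fun ζ => ω ζ * ‖ζ‖ ^ 2)
      (Metric.closedBall (0 : EuclideanSpace ℝ (Fin 3)) δ))
    (q : Fin 3 → ℝ)
    (Φ : EuclideanSpace ℝ (Fin 3) → ℝ) (hΦmeas : Measurable Φ)
    (hΦint : IntegrableOn (fun ζ => ω ζ * |Φ ζ| * ‖ζ‖)
      (Metric.closedBall (0 : EuclideanSpace ℝ (Fin 3)) δ))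
    (K : Matrix (Fin 3) (Fin 3) ℝ)
    (hK : ∀ i j, K i j =
      ∫ ζ in Metric.closedBall (0 : EuclideanSpace ℝ (Fin 3)) δ, ω ζ * ζ i * ζ j)
    (hKunit : IsUnit K)
    (g : Fin 3 → ℝ)
    (hg : ∀ i, g i = ∑ j, K⁻¹ i j *
      ∫ ζ in Metric.closedBall (0 : EuclideanSpace ℝ (Fin 3)) δ, ω ζ * Φ ζ * ζ j)
    (Q : EuclideanSpace ℝ (Fin 3) → ℝ)
    (hQ : ∀ ζ, Q ζ = ω ζ * ∑ i, q i * ∑ j, K⁻¹ i j * ζ j) :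
    (∑ i, q i * g i) =
      ∫ ζ in Metric.closedBall (0 : EuclideanSpace ℝ (Fin 3)) δ, Q ζ * Φ ζ := by
  have hint := integrableOn_mul_coord hωmeas hΦmeas hΦint
  have hQΦ : ∀ ζ, Q ζ * Φ ζ = ∑ i, ∑ j, q i * K⁻¹ i j * (ω ζ * Φ ζ * ζ j) := by
    intro ζ
    simp only [hQ, Finset.mul_sum, Finset.sum_mul]
    exact Finset.sum_congr rfl fun i _ => Finset.sum_congr rfl fun j _ => by ring
  simp only [hQΦ]
  rw [integral_finsetSum _ fun i _ => integrable_finsetSum _ fun j _ => (hint j).const_mul _]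
  refine Finset.sum_congr rfl fun i _ => ?_
  rw [integral_finsetSum _ fun j _ => (hint j).const_mul _, hg, Finset.mul_sum]
  exact Finset.sum_congr rfl fun j _ => by rw [integral_const_mul, mul_assoc]
end

section
/- Stabilization-energy rearrangement identity for the solid phase: let β : ℝ³ → ℝ and R, Y : ℝ³ → ℝ³ be measurable with ζ ↦ ω(ζ)‖Y(ζ)‖‖ζ‖, ζ ↦ |β(ζ)|‖R(ζ)‖‖Y(ζ)‖, and ζ ↦ |β(ζ)|‖R(ζ)‖‖ζ‖ integrable on H, and suppose the shape tensor K is invertible. Set F = (∫_H ω(ζ) (Y(ζ) ⊗ ζ) dζ) K⁻¹ and B = ∫_H β(ζ) (R(ζ) ⊗ ζ) dζ. Then ∫_H β(ζ) ⟨R(ζ), Y(ζ) − F ζ⟩ dζ = ∫_H ⟨β(ζ) R(ζ) − ω(ζ) B K⁻¹ ζ, Y(ζ)⟩ dζ; i.e., the stabilization force state T_s(ζ) = β(ζ) R(ζ) − ω(ζ) B K⁻¹ ζ reproduces the stabilization strain energy ∫_H β ⟨R, Y − Fζ⟩ dζ when paired with the deformation state Y. -/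
open MeasureTheory Matrix

/-- Products of components of two vector fields are integrable as soon as the product of
their norms is. -/
lemma integrable_weighted_components {α ι : Type*} [MeasurableSpace α] [Fintype ι]
    {μ : Measure α} {c : α → ℝ} {u v : α → EuclideanSpace ℝ ι}
    (hc : Measurable c) (hu : Measurable u) (hv : Measurable v)
    (h : Integrable (fun x => |c x| * ‖u x‖ * ‖v x‖) μ) (i j : ι) :
    Integrable (fun x => c x * u x i * v x j) μ := by
  refine h.mono' (by fun_prop) (.of_forall fun x => ?_)
  rw [norm_mul, norm_mul, Real.norm_eq_abs (c x)]
  gcongr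
  · exact PiLp.norm_apply_le (u x) i
  · exact PiLp.norm_apply_le (v x) j

/-- The Frobenius pairing moves a symmetric right factor from one side to the other. -/
lemma sum_sum_mul_mul_comm_of_isSymm {m n : Type*} [Fintype m] [Fintype n]
    {S : Matrix n n ℝ} (hS : S.IsSymm) (A B : Matrix m n ℝ) :
    ∑ i, ∑ j, (A * S) i j * B i j = ∑ i, ∑ j, (B * S) i j * A i j := by
  refine Finset.sum_congr rfl fun i _ => ?_
  simp only [Matrix.mul_apply, Finset.sum_mul]
  rw [Finset.sum_comm]
  refine Finset.sum_congr rfl fun j _ => Finset.sum_congr rfl fun k _ => ?_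
  rw [← hS.apply j k]
  ring

/-- Stabilization-energy rearrangement identity for the solid phase: the
stabilization force state `T_s(ζ) = β(ζ) R(ζ) − ω(ζ) B K⁻¹ ζ`, with
`B = ∫_H β (R ⊗ ζ)`, reproduces the stabilization strain energy
`∫_H β ⟨R, Y − Fζ⟩ dζ` when paired with the deformation state `Y`. -/
theorem stabilization_energy_rearrangement_solid
    (δ : ℝ) (hδ : 0 < δ)
    (ω : EuclideanSpace ℝ (Fin 3) → ℝ)
    (hωmeas : Measurable ω) (hωnn : ∀ ζ, 0 ≤ ω ζ)
    (hωint : IntegrableOn (fun ζ => ω ζ * ‖ζ‖ ^ 2)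
      (Metric.closedBall (0 : EuclideanSpace ℝ (Fin 3)) δ))
    (β : EuclideanSpace ℝ (Fin 3) → ℝ) (hβmeas : Measurable β)
    (R Y : EuclideanSpace ℝ (Fin 3) → EuclideanSpace ℝ (Fin 3))
    (hRmeas : Measurable R) (hYmeas : Measurable Y)
    (hYint : IntegrableOn (fun ζ => ω ζ * ‖Y ζ‖ * ‖ζ‖)
      (Metric.closedBall (0 : EuclideanSpace ℝ (Fin 3)) δ))
    (hβRYint : IntegrableOn (fun ζ => |β ζ| * ‖R ζ‖ * ‖Y ζ‖)
      (Metric.closedBall (0 : EuclideanSpace ℝ (Fin 3)) δ))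
    (hβRζint : IntegrableOn (fun ζ => |β ζ| * ‖R ζ‖ * ‖ζ‖)
      (Metric.closedBall (0 : EuclideanSpace ℝ (Fin 3)) δ))
    (K : Matrix (Fin 3) (Fin 3) ℝ)
    (hK : ∀ i j, K i j =
      ∫ ζ in Metric.closedBall (0 : EuclideanSpace ℝ (Fin 3)) δ, ω ζ * ζ i * ζ j)
    (hKunit : IsUnit K)
    (F : Matrix (Fin 3) (Fin 3) ℝ)
    (hF : F = (Matrix.of fun i j =>
      ∫ ζ in Metric.closedBall (0 : EuclideanSpace ℝ (Fin 3)) δ, ω ζ * Y ζ i * ζ j) * K⁻¹)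
    (B : Matrix (Fin 3) (Fin 3) ℝ)
    (hB : ∀ i j, B i j =
      ∫ ζ in Metric.closedBall (0 : EuclideanSpace ℝ (Fin 3)) δ, β ζ * R ζ i * ζ j) :
    (∫ ζ in Metric.closedBall (0 : EuclideanSpace ℝ (Fin 3)) δ,
        β ζ * ∑ i, R ζ i * (Y ζ i - ∑ j, F i j * ζ j)) =
      ∫ ζ in Metric.closedBall (0 : EuclideanSpace ℝ (Fin 3)) δ,
        ∑ i, (β ζ * R ζ i - ω ζ * ∑ j, (B * K⁻¹) i j * ζ j) * Y ζ i := by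
  set μ := (volume : Measure (EuclideanSpace ℝ (Fin 3))).restrict (Metric.closedBall 0 δ)
  have hRY := integrable_weighted_components (μ := μ) hβmeas hRmeas hYmeas hβRYint
  have hRζ := integrable_weighted_components (μ := μ) hβmeas hRmeas measurable_id hβRζint
  have hYζ := integrable_weighted_components (μ := μ) hωmeas hYmeas measurable_id
    (by simp only [abs_of_nonneg (hωnn _)]; exact hYint)
  simp only [id] at hRζ hYζ
  have hKsymm : K⁻¹.IsSymm := by
    have : K.IsSymm := .ext fun i j => by
      rw [hK, hK]
      congr! 2 with ζ
      ring
    rw [Matrix.IsSymm, Matrix.transpose_nonsing_inv, this.eq]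
  have split (G : Matrix (Fin 3) (Fin 3) ℝ) (c : EuclideanSpace ℝ (Fin 3) → ℝ)
      (Z : EuclideanSpace ℝ (Fin 3) → EuclideanSpace ℝ (Fin 3))
      (hZ : ∀ i j, Integrable (fun ζ => c ζ * Z ζ i * ζ j) μ) :
      ∫ ζ, (∑ i, β ζ * R ζ i * Y ζ i - ∑ i, ∑ j, G i j * (c ζ * Z ζ i * ζ j)) ∂μ =
        ∫ ζ, ∑ i, β ζ * R ζ i * Y ζ i ∂μ -
          ∑ i, ∑ j, G i j * ∫ ζ, c ζ * Z ζ i * ζ j ∂μ := by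
    have hG (i j : Fin 3) := (hZ i j).const_mul (G i j)
    rw [integral_sub (integrable_finsetSum _ fun i _ => hRY i i)
      (integrable_finsetSum _ fun i _ => integrable_finsetSum _ fun j _ => hG i j),
      integral_finsetSum _ fun i _ => integrable_finsetSum _ fun j _ => hG i j]
    simp only [integral_finsetSum _ fun j _ => hG _ j, integral_const_mul]
  calc
    _ = ∫ ζ, (∑ i, β ζ * R ζ i * Y ζ i - ∑ i, ∑ j, F i j * (β ζ * R ζ i * ζ j)) ∂μ := by
      congr! 2 with ζ
      simp only [Fin.sum_univ_three]
      ring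
    _ = ∫ ζ, (∑ i, β ζ * R ζ i * Y ζ i -
        ∑ i, ∑ j, (B * K⁻¹) i j * (ω ζ * Y ζ i * ζ j)) ∂μ := by
      rw [split F β R hRζ, split (B * K⁻¹) ω Y hYζ]
      simp only [← hB]
      rw [hF, sum_sum_mul_mul_comm_of_isSymm hKsymm]
      rfl
    _ = _ := by
      congr! 2 with ζ
      simp only [Fin.sum_univ_three]
      ring
end

section
/- Stabilization-energy rearrangement identity for the fluid phase: let λ, R : ℝ³ → ℝ and Φ : ℝ³ → ℝ be measurable with ζ ↦ ω(ζ)|Φ(ζ)|‖ζ‖, ζ ↦ |λ(ζ) R(ζ) Φ(ζ)|, and ζ ↦ |λ(ζ) R(ζ)|‖ζ‖ integrable on H, and suppose the shape tensor K is invertible. Set g = K⁻¹ (∫_H ω(ζ) Φ(ζ) ζ dζ) and b = ∫_H λ(ζ) R(ζ) ζ dζ. Then ∫_H λ(ζ) R(ζ) (Φ(ζ) − ⟨g, ζ⟩) dζ = ∫_H (λ(ζ) R(ζ) − ω(ζ) ⟨b, K⁻¹ ζ⟩) Φ(ζ) dζ; i.e., the stabilization flow state Q_s(ζ) = λ(ζ)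 R(ζ) − ω(ζ) ⟨b, K⁻¹ ζ⟩ reproduces the stabilization dissipation energy when paired with the pressure state Φ. -/
open MeasureTheory Matrix

/-- A measurable multiple of a coordinate is integrable as soon as the same multiple of the
norm is absolutely integrable. -/
lemma integrable_mul_coord {n : Type*} [Fintype n] {μ : Measure (EuclideanSpace ℝ n)}
    {f : EuclideanSpace ℝ n → ℝ} (hf : Measurable f)
    (h : Integrable (fun ζ => |f ζ| * ‖ζ‖) μ) (i : n) :
    Integrable (fun ζ => f ζ * ζ i) μ := by
  refine h.mono' (by fun_prop) (.of_forall fun ζ => ?_)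
  rw [norm_mul, Real.norm_eq_abs]
  exact mul_le_mul_of_nonneg_left (PiLp.norm_apply_le ζ i) (abs_nonneg _)

/-- The integral of `F - f ⟨c, ζ⟩` in terms of the first moments of `f`. -/
lemma integral_sub_mul_sum_coord {n : Type*} [Fintype n] {μ : Measure (EuclideanSpace ℝ n)}
    {F f : EuclideanSpace ℝ n → ℝ} (hF : Integrable F μ)
    (hf : ∀ i, Integrable (fun ζ => f ζ * ζ i) μ) (c : n → ℝ) :
    ∫ ζ, (F ζ - ∑ i, c i * (f ζ * ζ i)) ∂μ = ∫ ζ, F ζ ∂μ - ∑ i, c i * ∫ ζ, f ζ * ζ i ∂μ := by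
  rw [integral_sub hF (integrable_finsetSum _ fun i _ => (hf i).const_mul _),
    integral_finsetSum _ fun i _ => (hf i).const_mul _]
  simp only [integral_const_mul]

/-- Stabilization-energy rearrangement identity for the fluid phase: the
stabilization flow state `Q_s(ζ) = λ(ζ) R(ζ) − ω(ζ) ⟨b, K⁻¹ ζ⟩`, with
`b = ∫_H λ R ζ dζ`, reproduces the stabilization dissipation energy
`∫_H λ R (Φ − ⟨g, ζ⟩) dζ` when paired with the pressure state `Φ`. -/
theorem stabilization_energy_rearrangement_fluid
    (δ : ℝ) (hδ : 0 < δ)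
    (ω : EuclideanSpace ℝ (Fin 3) → ℝ)
    (hωmeas : Measurable ω) (hωnn : ∀ ζ, 0 ≤ ω ζ)
    (hωint : IntegrableOn (fun ζ => ω ζ * ‖ζ‖ ^ 2)
      (Metric.closedBall (0 : EuclideanSpace ℝ (Fin 3)) δ))
    (lam R Φ : EuclideanSpace ℝ (Fin 3) → ℝ)
    (hlammeas : Measurable lam) (hRmeas : Measurable R) (hΦmeas : Measurable Φ)
    (hΦint : IntegrableOn (fun ζ => ω ζ * |Φ ζ| * ‖ζ‖)
      (Metric.closedBall (0 : EuclideanSpace ℝ (Fin 3)) δ))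
    (hlamRΦint : IntegrableOn (fun ζ => |lam ζ * R ζ * Φ ζ|)
      (Metric.closedBall (0 : EuclideanSpace ℝ (Fin 3)) δ))
    (hlamRζint : IntegrableOn (fun ζ => |lam ζ * R ζ| * ‖ζ‖)
      (Metric.closedBall (0 : EuclideanSpace ℝ (Fin 3)) δ))
    (K : Matrix (Fin 3) (Fin 3) ℝ)
    (hK : ∀ i j, K i j =
      ∫ ζ in Metric.closedBall (0 : EuclideanSpace ℝ (Fin 3)) δ, ω ζ * ζ i * ζ j)
    (hKunit : IsUnit K)
    (g : Fin 3 → ℝ)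
    (hg : ∀ i, g i = ∑ j, K⁻¹ i j *
      ∫ ζ in Metric.closedBall (0 : EuclideanSpace ℝ (Fin 3)) δ, ω ζ * Φ ζ * ζ j)
    (b : Fin 3 → ℝ)
    (hb : ∀ i, b i =
      ∫ ζ in Metric.closedBall (0 : EuclideanSpace ℝ (Fin 3)) δ, lam ζ * R ζ * ζ i) :
    (∫ ζ in Metric.closedBall (0 : EuclideanSpace ℝ (Fin 3)) δ,
        lam ζ * R ζ * (Φ ζ - ∑ i, g i * ζ i)) =
      ∫ ζ in Metric.closedBall (0 : EuclideanSpace ℝ (Fin 3)) δ,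
        (lam ζ * R ζ - ω ζ * ∑ i, b i * ∑ j, K⁻¹ i j * ζ j) * Φ ζ := by
  have hF : IntegrableOn (fun ζ => lam ζ * R ζ * Φ ζ)
      (Metric.closedBall (0 : EuclideanSpace ℝ (Fin 3)) δ) :=
    hlamRΦint.mono' (by fun_prop) (.of_forall fun _ => le_rfl)
  have hb' := integrable_mul_coord (hlammeas.mul hRmeas) hlamRζint
  have hg' := integrable_mul_coord (hωmeas.mul hΦmeas)
    (by simpa only [Pi.mul_apply, abs_mul, abs_of_nonneg (hωnn _), IntegrableOn] using hΦint)
  simp only [Pi.mul_apply] at hb' hg'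
  have h₁ := integral_sub_mul_sum_coord hF hb' g
  have h₂ := integral_sub_mul_sum_coord hF hg' fun j => ∑ i, b i * K⁻¹ i j
  calc
    _ = _ := by
      simpa only [mul_sub, Finset.mul_sum, mul_left_comm] using h₁
    _ = _ := by
      congr 1
      simp only [← hb, hg, Finset.sum_mul]
      rw [Finset.sum_comm]
      refine Finset.sum_congr rfl fun j _ => Finset.sum_congr rfl fun i _ => ?_
      ring
    _ = _ := h₂.symm
    _ = _ := by
      congr 1 with ζ
      simp only [sub_mul, Finset.mul_sum, Finset.sum_mul]
      rw [Finset.sum_comm]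
      congr 1
      refine Finset.sum_congr rfl fun i _ => Finset.sum_congr rfl fun j _ => ?_
      ring
end

section
/- Simplification of the stabilized force state for influence-proportional weights: let Y : ℝ³ → ℝ³ be measurable with ζ ↦ ω(ζ)‖Y(ζ)‖‖ζ‖ integrable on H, let K be invertible, let F = (∫_H ω(ζ) (Y(ζ) ⊗ ζ) dζ) K⁻¹, and let R(ζ) = Y(ζ) − F ζ be the residual deformation state. If the weighting function is proportional to the influence function, β(ζ) = c ω(ζ) for a constant c ∈ ℝ, then B = ∫_H β(ζ) (R(ζ) ⊗ ζ) dζ = 0, and consequently the full stabilization force state β(ζ) R(ζ) − ω(ζ) B K⁻¹ ζ reduces to β(ζ) R(ζ) = c ω(ζ) R(ζ) for every ζ. -/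
open MeasureTheory Matrix

/-- The entries of the weighted outer product `w (Z ⊗ ζ)` are integrable as soon as the weighted
product of the norms is. -/
theorem integrable_weight_mul_apply_mul_apply {ι κ : Type*} [Fintype ι] [Fintype κ]
    {μ : Measure (EuclideanSpace ℝ κ)} {w : EuclideanSpace ℝ κ → ℝ}
    {Z : EuclideanSpace ℝ κ → EuclideanSpace ℝ ι} (hw : Measurable w) (hZ : Measurable Z)
    (hint : Integrable (fun ζ => w ζ * ‖Z ζ‖ * ‖ζ‖) μ) (i : ι) (j : κ) :
    Integrable (fun ζ => w ζ * Z ζ i * ζ j) μ := by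
  refine hint.mono (by fun_prop) (.of_forall fun ζ => ?_)
  simp only [norm_mul, norm_norm]
  gcongr
  · exact PiLp.norm_apply_le (Z ζ) i
  · exact PiLp.norm_apply_le ζ j

/-- Simplification of the stabilized force state for influence-proportional weights:
if `β(ζ) = c ω(ζ)`, then `B = ∫_H β (R ⊗ ζ) dζ = 0` and the stabilization force
state `β R − ω B K⁻¹ ζ` reduces to `β R = c ω R`. -/
theorem stabilized_force_state_simplification
    (δ : ℝ) (hδ : 0 < δ)
    (ω : EuclideanSpace ℝ (Fin 3) → ℝ)
    (hωmeas : Measurable ω) (hωnn : ∀ ζ, 0 ≤ ω ζ)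
    (hωint : IntegrableOn (fun ζ => ω ζ * ‖ζ‖ ^ 2)
      (Metric.closedBall (0 : EuclideanSpace ℝ (Fin 3)) δ))
    (Y : EuclideanSpace ℝ (Fin 3) → EuclideanSpace ℝ (Fin 3)) (hYmeas : Measurable Y)
    (hYint : IntegrableOn (fun ζ => ω ζ * ‖Y ζ‖ * ‖ζ‖)
      (Metric.closedBall (0 : EuclideanSpace ℝ (Fin 3)) δ))
    (K : Matrix (Fin 3) (Fin 3) ℝ)
    (hK : ∀ i j, K i j =
      ∫ ζ in Metric.closedBall (0 : EuclideanSpace ℝ (Fin 3)) δ, ω ζ * ζ i * ζ j)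
    (hKunit : IsUnit K)
    (F : Matrix (Fin 3) (Fin 3) ℝ)
    (hF : F = (Matrix.of fun i j =>
      ∫ ζ in Metric.closedBall (0 : EuclideanSpace ℝ (Fin 3)) δ, ω ζ * Y ζ i * ζ j) * K⁻¹)
    (R : EuclideanSpace ℝ (Fin 3) → Fin 3 → ℝ)
    (hR : ∀ ζ i, R ζ i = Y ζ i - ∑ j, F i j * ζ j)
    (c : ℝ)
    (β : EuclideanSpace ℝ (Fin 3) → ℝ)
    (hβ : ∀ ζ, β ζ = c * ω ζ)
    (B : Matrix (Fin 3) (Fin 3) ℝ)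
    (hB : ∀ i j, B i j =
      ∫ ζ in Metric.closedBall (0 : EuclideanSpace ℝ (Fin 3)) δ, β ζ * R ζ i * ζ j) :
    B = 0 ∧
      ∀ ζ i, β ζ * R ζ i - ω ζ * ∑ j, (B * K⁻¹) i j * ζ j = c * ω ζ * R ζ i := by
  set μ := volume.restrict (Metric.closedBall (0 : EuclideanSpace ℝ (Fin 3)) δ)
  have hY : ∀ i j, Integrable (fun ζ => ω ζ * Y ζ i * ζ j) μ :=
    integrable_weight_mul_apply_mul_apply hωmeas hYmeas hYint
  have hζ : ∀ i j, Integrable (fun ζ => ω ζ * ζ i * ζ j) μ :=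
    integrable_weight_mul_apply_mul_apply hωmeas measurable_id
      (by simp only [mul_assoc, ← sq]; exact hωint)
  have hFK : F * K = Matrix.of fun i j => ∫ ζ, ω ζ * Y ζ i * ζ j ∂μ := by
    rw [hF, Matrix.nonsing_inv_mul_cancel_right _ _ ((Matrix.isUnit_iff_isUnit_det K).1 hKunit)]
  have hB0 : B = 0 := by
    ext i j
    have hsplit : ∀ ζ, β ζ * R ζ i * ζ j =
        c * (ω ζ * Y ζ i * ζ j - ∑ k, F i k * (ω ζ * ζ k * ζ j)) := by
      intro ζ
      simp only [hβ, hR, Fin.sum_univ_three]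
      ring
    have hFKij := congrFun (congrFun hFK i) j
    simp only [Matrix.mul_apply, Matrix.of_apply, hK] at hFKij
    simp_rw [hB, hsplit]
    rw [integral_const_mul, integral_sub (hY i j)
      (integrable_finsetSum _ fun k _ => (hζ k j).const_mul _),
      integral_finsetSum _ fun k _ => (hζ k j).const_mul _]
    simp_rw [integral_const_mul]
    rw [hFKij, sub_self, mul_zero, Matrix.zero_apply]
  refine ⟨hB0, fun ζ i => ?_⟩
  simp [hB0, hβ]
end

section
/- Calibration of the solid micro-elastic modulus in three dimensions: fix δ > 0 and an elastic bulk modulus K^e > 0. For a constant C ∈ ℝ, the peridynamic strain-energy rate under isotropic deformation of stretch rate Ċ₁, namely (1/2) ∫_{‖ζ‖ ≤ δ} (1/2) C Ċ₁² ‖ζ‖ dζ = (π C δ⁴ / 4) Ċ₁², equals the classical elastic strain-energy rate (9 K^e / 2) Ċ₁² for every Ċ₁ ∈ ℝ if and only if C = 18 K^e / (π δ⁴). -/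
open MeasureTheory

/-- The integral of the Euclidean norm over the closed ball of radius `δ` in `ℝ³` is `π δ⁴`. -/
theorem integral_norm_closedBall_fin_three {δ : ℝ} (hδ : 0 ≤ δ) :
    ∫ ζ in Metric.closedBall (0 : EuclideanSpace ℝ (Fin 3)) δ, ‖ζ‖ = Real.pi * δ ^ 4 := by
  have h_ball : (volume : Measure (EuclideanSpace ℝ (Fin 3))).real (Metric.ball 0 1)
      = 4 / 3 * Real.pi := by
    rw [Measure.real, EuclideanSpace.volume_ball_fin_three, ENNReal.ofReal_one, one_pow, one_mul,
      ENNReal.toReal_ofReal (by positivity)]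
    ring
  have h_radial : ∫ y in Set.Ioi (0 : ℝ), y ^ 2 • (Set.Iic δ).indicator id y = δ ^ 4 / 4 := by
    have h_ind : (fun y : ℝ => y ^ 2 • (Set.Iic δ).indicator id y)
        = (Set.Iic δ).indicator fun y => y ^ 3 := by
      ext y
      by_cases hy : y ∈ Set.Iic δ
      · simp only [Set.indicator_of_mem hy, id, smul_eq_mul]
        ring
      · simp [Set.indicator_of_notMem hy]
    rw [h_ind, setIntegral_indicator measurableSet_Iic, Set.Ioi_inter_Iic,
      ← intervalIntegral.integral_of_le hδ, integral_pow]
    norm_num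
  calc ∫ ζ in Metric.closedBall (0 : EuclideanSpace ℝ (Fin 3)) δ, ‖ζ‖
      = ∫ ζ : EuclideanSpace ℝ (Fin 3), (Set.Iic δ).indicator id ‖ζ‖ := by
        rw [← integral_indicator Metric.isClosed_closedBall.measurableSet]
        refine integral_congr_ae (.of_forall fun ζ => ?_)
        by_cases hζ : ‖ζ‖ ≤ δ <;> simp [Set.indicator, hζ]
    _ = Real.pi * δ ^ 4 := by
        rw [integral_fun_norm_addHaar volume ((Set.Iic δ).indicator id), h_ball,
          finrank_euclideanSpace_fin, h_radial, nsmul_eq_mul, smul_eq_mul]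
        push_cast
        ring

/-- Calibration of the solid micro-elastic modulus in three dimensions: the
peridynamic strain-energy rate `(1/2) ∫_{‖ζ‖≤δ} (1/2) C Ċ₁² ‖ζ‖ dζ` equals
`(π C δ⁴ / 4) Ċ₁²`, and it equals the classical elastic strain-energy rate
`(9 Kᵉ / 2) Ċ₁²` for every `Ċ₁` if and only if `C = 18 Kᵉ / (π δ⁴)`. -/
theorem micro_elastic_modulus_calibration
    (δ : ℝ) (hδ : 0 < δ) (Ke : ℝ) (hKe : 0 < Ke) (C : ℝ) :
    (∀ c₁ : ℝ,
      (1 / 2) * ∫ ζ in Metric.closedBall (0 : EuclideanSpace ℝ (Fin 3)) δ,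
          (1 / 2) * C * c₁ ^ 2 * ‖ζ‖
        = (Real.pi * C * δ ^ 4 / 4) * c₁ ^ 2) ∧
    ((∀ c₁ : ℝ,
      (1 / 2) * ∫ ζ in Metric.closedBall (0 : EuclideanSpace ℝ (Fin 3)) δ,
          (1 / 2) * C * c₁ ^ 2 * ‖ζ‖
        = (9 * Ke / 2) * c₁ ^ 2) ↔ C = 18 * Ke / (Real.pi * δ ^ 4)) := by
  have h_rate : ∀ c₁ : ℝ,
      (1 / 2) * ∫ ζ in Metric.closedBall (0 : EuclideanSpace ℝ (Fin 3)) δ,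
          (1 / 2) * C * c₁ ^ 2 * ‖ζ‖
        = (Real.pi * C * δ ^ 4 / 4) * c₁ ^ 2 := fun c₁ => by
    rw [integral_const_mul, integral_norm_closedBall_fin_three hδ.le]
    ring
  have h_pos : 0 < Real.pi * δ ^ 4 := by positivity
  refine ⟨h_rate, ?_⟩
  simp only [h_rate, eq_div_iff h_pos.ne']
  exact ⟨fun h => by linarith [h 1], fun h c₁ => by linear_combination c₁ ^ 2 / 4 * h⟩
end

section
/- Phreatic (mixed-state) correspondence energy identity for the solid skeleton: let H₁ and H₂ be disjoint measurable subsets of H with H₁ ∪ H₂ = H (the saturated and unsaturated parts of the horizon of a phreatic material point), let σ⁽¹⁾ and σ⁽²⁾ be symmetric 3×3 real matrices, let Ẏ : ℝ³ → ℝ³ be measurable with ζ ↦ ω(ζ)‖Ẏ(ζ)‖‖ζ‖ integrable on H, and suppose the shape tensor K is invertible. For i = 1, 2 define L⁽ⁱ⁾ = (∫_{H_i} ω(ζ) (Ẏ(ζ) ⊗ ζ) dζ) K⁻¹, D⁽ⁱ⁾ = (L⁽ⁱ⁾ + (L⁽ⁱ⁾)ᵀ)/2, and T⁽ⁱ⁾(ζ)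 = ω(ζ) σ⁽ⁱ⁾ K⁻¹ ζ. Then tr(σ⁽¹⁾ D⁽¹⁾) + tr(σ⁽²⁾ D⁽²⁾) = ∫_{H₁} ⟨T⁽¹⁾(ζ), Ẏ(ζ)⟩ dζ + ∫_{H₂} ⟨T⁽²⁾(ζ), Ẏ(ζ)⟩ dζ. -/
open MeasureTheory Matrix

theorem Matrix.IsSymm.trace_mul_symmetrization {n R : Type*} [Fintype n] [Field R] [CharZero R]
    {σ : Matrix n n R} (hσ : σ.IsSymm) (L : Matrix n n R) :
    (σ * ((2⁻¹ : R) • (L + Lᵀ))).trace = (σ * L).trace := by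
  have h : (σ * Lᵀ).trace = (σ * L).trace := by
    rw [← trace_transpose, transpose_mul, transpose_transpose, hσ.eq, trace_mul_comm]
  rw [mul_smul_comm, trace_smul, Matrix.mul_add, trace_add, h, smul_eq_mul]
  ring

theorem Matrix.IsSymm.trace_mul_mul_eq_sum {n R : Type*} [Fintype n] [CommRing R]
    {σ A : Matrix n n R} (hσ : σ.IsSymm) (hA : A.IsSymm) (M : Matrix n n R) :
    (σ * (M * A)).trace = ∑ i, ∑ j, (σ * A) i j * M i j := by
  rw [trace_mul_comm, Matrix.mul_assoc, trace_mul_comm, ← trace_transpose, transpose_mul,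
    transpose_mul, hσ.eq, hA.eq, trace_mul_comm, trace]
  simp [mul_apply, mul_comm]

theorem integrableOn_weight_mul_coord_mul_coord {n : Type*} [Fintype n]
    {ω : EuclideanSpace ℝ n → ℝ} (hω : Measurable ω) (hω0 : ∀ ζ, 0 ≤ ω ζ)
    {V : EuclideanSpace ℝ n → EuclideanSpace ℝ n} (hV : Measurable V)
    {S : Set (EuclideanSpace ℝ n)} (h : IntegrableOn (fun ζ => ω ζ * ‖V ζ‖ * ‖ζ‖) S) (i j : n) :
    IntegrableOn (fun ζ => ω ζ * V ζ i * ζ j) S := by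
  refine h.mono' (by fun_prop) (Filter.Eventually.of_forall fun ζ => ?_)
  rw [norm_mul, norm_mul, Real.norm_of_nonneg (hω0 ζ)]
  gcongr
  · exact mul_nonneg (hω0 ζ) (norm_nonneg _)
  · exact hω0 ζ
  · exact PiLp.norm_apply_le (V ζ) i
  · exact PiLp.norm_apply_le ζ j

/-- The partial stress power over `S` equals the partial peridynamic internal power over `S`. -/
theorem trace_mul_symmetrization_eq_setIntegral {n : Type*} [Fintype n]
    {ω : EuclideanSpace ℝ n → ℝ} (hω : Measurable ω) (hω0 : ∀ ζ, 0 ≤ ω ζ)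
    {V : EuclideanSpace ℝ n → EuclideanSpace ℝ n} (hV : Measurable V)
    {S : Set (EuclideanSpace ℝ n)} (h : IntegrableOn (fun ζ => ω ζ * ‖V ζ‖ * ‖ζ‖) S)
    {σ A L D : Matrix n n ℝ} (hσ : σ.IsSymm) (hA : A.IsSymm)
    (hL : L = (Matrix.of fun i j => ∫ ζ in S, ω ζ * V ζ i * ζ j) * A)
    (hD : D = (2⁻¹ : ℝ) • (L + Lᵀ))
    {T : EuclideanSpace ℝ n → n → ℝ} (hT : ∀ ζ i, T ζ i = ω ζ * ∑ j, (σ * A) i j * ζ j) :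
    (σ * D).trace = ∫ ζ in S, ∑ i, T ζ i * V ζ i := by
  have hint (i j : n) : IntegrableOn (fun ζ => (σ * A) i j * (ω ζ * V ζ i * ζ j)) S :=
    (integrableOn_weight_mul_coord_mul_coord hω hω0 hV h i j).const_mul _
  have hpower (ζ : EuclideanSpace ℝ n) :
      ∑ i, T ζ i * V ζ i = ∑ i, ∑ j, (σ * A) i j * (ω ζ * V ζ i * ζ j) := by
    refine Finset.sum_congr rfl fun i _ => ?_
    rw [hT, Finset.mul_sum, Finset.sum_mul]
    exact Finset.sum_congr rfl fun j _ => by ring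
  rw [hD, hσ.trace_mul_symmetrization, hL, hσ.trace_mul_mul_eq_sum hA]
  simp_rw [hpower]
  rw [integral_finsetSum _ fun i _ => integrable_finsetSum _ fun j _ => hint i j]
  refine Finset.sum_congr rfl fun i _ => ?_
  rw [integral_finsetSum _ fun j _ => hint i j]
  exact Finset.sum_congr rfl fun j _ => (integral_const_mul _ _).symm

/-- Phreatic (mixed-state) correspondence energy identity for the solid skeleton:
with the horizon partitioned into a saturated part `H₁` and an unsaturated part
`H₂`, the sum of the two partial stress powers `tr(σ⁽ⁱ⁾ D⁽ⁱ⁾)` equals the sum of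
the two partial peridynamic internal powers. -/
theorem phreatic_correspondence_energy_identity_solid
    (δ : ℝ) (hδ : 0 < δ)
    (ω : EuclideanSpace ℝ (Fin 3) → ℝ)
    (hωmeas : Measurable ω) (hωnn : ∀ ζ, 0 ≤ ω ζ)
    (hωint : IntegrableOn (fun ζ => ω ζ * ‖ζ‖ ^ 2)
      (Metric.closedBall (0 : EuclideanSpace ℝ (Fin 3)) δ))
    (H₁ H₂ : Set (EuclideanSpace ℝ (Fin 3)))
    (hH₁ : MeasurableSet H₁) (hH₂ : MeasurableSet H₂)
    (hdisj : Disjoint H₁ H₂)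
    (hunion : H₁ ∪ H₂ = Metric.closedBall (0 : EuclideanSpace ℝ (Fin 3)) δ)
    (σ₁ σ₂ : Matrix (Fin 3) (Fin 3) ℝ) (hσ₁ : σ₁.IsSymm) (hσ₂ : σ₂.IsSymm)
    (V : EuclideanSpace ℝ (Fin 3) → EuclideanSpace ℝ (Fin 3)) (hVmeas : Measurable V)
    (hVint : IntegrableOn (fun ζ => ω ζ * ‖V ζ‖ * ‖ζ‖)
      (Metric.closedBall (0 : EuclideanSpace ℝ (Fin 3)) δ))
    (K : Matrix (Fin 3) (Fin 3) ℝ)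
    (hK : ∀ i j, K i j =
      ∫ ζ in Metric.closedBall (0 : EuclideanSpace ℝ (Fin 3)) δ, ω ζ * ζ i * ζ j)
    (hKunit : IsUnit K)
    (L₁ L₂ D₁ D₂ : Matrix (Fin 3) (Fin 3) ℝ)
    (hL₁ : L₁ = (Matrix.of fun i j => ∫ ζ in H₁, ω ζ * V ζ i * ζ j) * K⁻¹)
    (hL₂ : L₂ = (Matrix.of fun i j => ∫ ζ in H₂, ω ζ * V ζ i * ζ j) * K⁻¹)
    (hD₁ : D₁ = (2⁻¹ : ℝ) • (L₁ + L₁ᵀ))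
    (hD₂ : D₂ = (2⁻¹ : ℝ) • (L₂ + L₂ᵀ))
    (T₁ T₂ : EuclideanSpace ℝ (Fin 3) → Fin 3 → ℝ)
    (hT₁ : ∀ ζ i, T₁ ζ i = ω ζ * ∑ j, (σ₁ * K⁻¹) i j * ζ j)
    (hT₂ : ∀ ζ i, T₂ ζ i = ω ζ * ∑ j, (σ₂ * K⁻¹) i j * ζ j) :
    (σ₁ * D₁).trace + (σ₂ * D₂).trace =
      (∫ ζ in H₁, ∑ i, T₁ ζ i * V ζ i) + ∫ ζ in H₂, ∑ i, T₂ ζ i * V ζ i := by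
  have hKsymm : K.IsSymm := Matrix.IsSymm.ext fun i j => by
    rw [hK, hK]
    exact integral_congr_ae (Filter.Eventually.of_forall fun ζ => mul_right_comm _ _ _)
  have hKinv : K⁻¹.IsSymm := by
    rw [Matrix.IsSymm, transpose_nonsing_inv, hKsymm.eq]
  rw [trace_mul_symmetrization_eq_setIntegral hωmeas hωnn hVmeas
      (hVint.mono_set (hunion ▸ Set.subset_union_left)) hσ₁ hKinv hL₁ hD₁ hT₁,
    trace_mul_symmetrization_eq_setIntegral hωmeas hωnn hVmeas
      (hVint.mono_set (hunion ▸ Set.subset_union_right)) hσ₂ hKinv hL₂ hD₂ hT₂]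
end
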